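/- Let X be a real Banach space and r ∈ [2, ∞) such that X satisfies condition (C_r) with constants k₁, k₂ > 0, and write φ(x) = ‖x‖^r. Let (Ω, 𝒜, P) be a probability space and Y = L^r(Ω; X). Then the second Fréchet derivative of ψ : Y → ℝ, ψ(y) = ‖y‖_{L^r(Ω;X)}^r, is given by ψ''(y)(u, v) = ∫_Ω φ''(y(ω))(u(ω), v(ω)) dP(ω) for all y, u, v ∈ L^r(Ω; X). -/

import Mathlib

open MeasureTheory

/-- A real Banach space `X` satisfies condition `(C_r)` with constants `k₁, k₂ > 0` if the
function `φ : X → ℝ`, `φ x = ‖x‖^r`, is twice continuously Fréchet differentiable and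
`‖φ'(x)‖ ≤ k₁ ‖x‖^(r-1)` and `‖φ''(x)‖ ≤ k₂ ‖x‖^(r-2)` for all `x ∈ X`. -/
def ConditionCr (X : Type*) [NormedAddCommGroup X] [NormedSpace ℝ X]
    (r k₁ k₂ : ℝ) : Prop :=
  ContDiff ℝ 2 (fun x : X => ‖x‖ ^ r) ∧
  (∀ x : X, ‖fderiv ℝ (fun x : X => ‖x‖ ^ r) x‖ ≤ k₁ * ‖x‖ ^ (r - 1)) ∧
  (∀ x : X, ‖fderiv ℝ (fderiv ℝ (fun x : X => ‖x‖ ^ r)) x‖ ≤ k₂ * ‖x‖ ^ (r - 2))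

open Filter Topology ENNReal

lemma holderTriple_ofReal_div {r s : ℝ} (hr : 0 < r) (hs : 0 ≤ s) :
    (ENNReal.ofReal r / ENNReal.ofReal s).HolderTriple (ENNReal.ofReal r)
      (ENNReal.ofReal r / ENNReal.ofReal (s + 1)) := by
  have hr' : ENNReal.ofReal r ≠ 0 := by simpa using hr
  constructor
  rw [ENNReal.inv_div (Or.inl ENNReal.ofReal_ne_top) (Or.inr hr'),
    ENNReal.inv_div (Or.inl ENNReal.ofReal_ne_top) (Or.inr hr'), ENNReal.ofReal_add hs zero_le_one,
    ENNReal.ofReal_one, ENNReal.add_div, one_div]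

lemma fact_one_le_ofReal_div {r s : ℝ} (hr : 0 < r) (hs : s ≤ r) :
    Fact (1 ≤ ENNReal.ofReal r / ENNReal.ofReal s) := by
  refine ⟨?_⟩
  rw [ENNReal.le_div_iff_mul_le (Or.inr (by simpa using hr)) (Or.inl ENNReal.ofReal_ne_top),
    one_mul]
  exact ENNReal.ofReal_le_ofReal hs

section Lp

variable {X E Ω : Type*} [NormedAddCommGroup X] [NormedAddCommGroup E] [MeasurableSpace Ω]
  {μ : Measure Ω}

lemma lintegral_enorm_rpow_eq {r : ℝ} (hr : 0 < r) (f : Ω → X) :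
    ∫⁻ ω, ‖f ω‖ₑ ^ r ∂μ = eLpNorm f (ENNReal.ofReal r) μ ^ r := by
  rw [eLpNorm_eq_lintegral_rpow_enorm_toReal (by simpa using hr) ENNReal.ofReal_ne_top,
    ENNReal.toReal_ofReal hr.le, ← ENNReal.rpow_mul, one_div_mul_cancel hr.ne', ENNReal.rpow_one]

lemma norm_rpow_eq_integral {r : ℝ} (hr : 0 < r) (y : Lp X (ENNReal.ofReal r) μ) :
    ‖y‖ ^ r = ∫ ω, ‖y ω‖ ^ r ∂μ := by
  have h0 : 0 ≤ ∫ ω, ‖y ω‖ ^ r ∂μ := integral_nonneg fun ω => by positivity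
  rw [Lp.norm_def, (Lp.memLp y).eLpNorm_eq_integral_rpow_norm (by simpa using hr)
    ENNReal.ofReal_ne_top, ENNReal.toReal_ofReal hr.le, ENNReal.toReal_ofReal (by positivity),
    ← Real.rpow_mul h0, inv_mul_cancel₀ hr.ne', Real.rpow_one]

lemma memLp_comp_of_norm_le_rpow {G : X → E} (hG : Continuous G) {k s r : ℝ} (hs : 0 ≤ s)
    (hb : ∀ x, ‖G x‖ ≤ k * ‖x‖ ^ s) (y : Lp X (ENNReal.ofReal r) μ) :
    MemLp (fun ω => G (y ω)) (ENNReal.ofReal r / ENNReal.ofReal s) μ := by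
  have h := (Lp.memLp y).norm_rpow_div (ENNReal.ofReal s)
  rw [ENNReal.toReal_ofReal hs] at h
  exact (h.const_mul k).mono' (hG.comp_aestronglyMeasurable (Lp.aestronglyMeasurable y))
    (ae_of_all _ fun ω => hb _)

end Lp

section Nemytskii

variable {X E Ω : Type*} [NormedAddCommGroup X] [NormedSpace ℝ X]
  [NormedAddCommGroup E] [NormedSpace ℝ E] [MeasurableSpace Ω] {μ : Measure Ω}

/-- The norm of the first-order Taylor remainder of `F` at `x`, divided by the norm of the
increment `h`. -/
noncomputable def taylorQuotient (F : X → E) (x h : X) : ℝ :=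
  ‖F (x + h) - F x - fderiv ℝ F x h‖ / ‖h‖

lemma taylorQuotient_nonneg (F : X → E) (x h : X) : 0 ≤ taylorQuotient F x h := by
  unfold taylorQuotient; positivity

lemma taylorQuotient_mul_norm (F : X → E) (x h : X) :
    taylorQuotient F x h * ‖h‖ = ‖F (x + h) - F x - fderiv ℝ F x h‖ := by
  unfold taylorQuotient
  rcases eq_or_ne h 0 with rfl | hh
  · simp
  · exact div_mul_cancel₀ _ (norm_ne_zero_iff.mpr hh)

lemma tendsto_taylorQuotient {F : X → E} {x : X} (hF : DifferentiableAt ℝ F x) :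
    Tendsto (taylorQuotient F x) (𝓝 0) (𝓝 0) :=
  (hasFDerivAt_iff_isLittleO_nhds_zero.1 hF.hasFDerivAt).norm_norm.tendsto_div_nhds_zero

lemma taylorQuotient_le {F : X → E} (hF : Differentiable ℝ F) {k s : ℝ} (hk : 0 ≤ k) (hs : 0 ≤ s)
    (hb : ∀ x, ‖fderiv ℝ F x‖ ≤ k * ‖x‖ ^ s) (x h : X) :
    taylorQuotient F x h ≤ 2 * k * (‖x‖ + ‖h‖) ^ s := by
  have key : ‖F (x + h) - F x‖ ≤ k * (‖x‖ + ‖h‖) ^ s * ‖(x + h) - x‖ := by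
    refine Convex.norm_image_sub_le_of_norm_fderiv_le (𝕜 := ℝ)
      (s := Metric.closedBall 0 (‖x‖ + ‖h‖)) (fun z _ => hF z) (fun z hz => ?_)
      (convex_closedBall _ _) ?_ ?_
    · refine (hb z).trans ?_
      have : ‖z‖ ≤ ‖x‖ + ‖h‖ := by simpa using hz
      gcongr
    · simp
    · simpa using norm_add_le x h
  have h2 : ‖fderiv ℝ F x h‖ ≤ k * (‖x‖ + ‖h‖) ^ s * ‖h‖ := by
    refine (ContinuousLinearMap.le_opNorm _ _).trans ?_
    gcongr
    refine (hb x).trans ?_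
    gcongr
    simp
  refine div_le_of_le_mul₀ (norm_nonneg _) (by positivity) ?_
  rw [add_sub_cancel_left] at key
  linarith [norm_sub_le (F (x + h) - F x) (fderiv ℝ F x h)]

lemma aestronglyMeasurable_taylorQuotient {F : X → E} (hF : ContDiff ℝ 1 F) {y h : Ω → X}
    (hy : AEStronglyMeasurable y μ) (hh : AEStronglyMeasurable h μ) :
    AEStronglyMeasurable (fun ω => taylorQuotient F (y ω) (h ω)) μ := by
  have h1 : Continuous fun p : X × X => ‖F (p.1 + p.2) - F p.1 - fderiv ℝ F p.1 p.2‖ := by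
    have := hF.continuous
    have := hF.continuous_fderiv one_ne_zero
    fun_prop
  exact ((h1.comp_aestronglyMeasurable (hy.prodMk hh)).aemeasurable.div
    hh.norm.aemeasurable).aestronglyMeasurable

lemma enorm_taylorQuotient_rpow_le {F : X → E} (hF : Differentiable ℝ F) {k s r : ℝ} (hk : 0 ≤ k)
    (hs : 0 < s) (hr : 1 ≤ r) (hb : ∀ x, ‖fderiv ℝ F x‖ ≤ k * ‖x‖ ^ s) (x h : X) :
    ‖taylorQuotient F x h‖ₑ ^ (r / s) ≤
      ENNReal.ofReal (2 * k) ^ (r / s) * 2 ^ (r - 1) * ‖x‖ₑ ^ r +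
      ENNReal.ofReal (2 * k) ^ (r / s) * 2 ^ (r - 1) * ‖h‖ₑ ^ r := by
  have h1 : ‖taylorQuotient F x h‖ₑ ≤ ENNReal.ofReal (2 * k) * (‖x‖ₑ + ‖h‖ₑ) ^ s := by
    rw [Real.enorm_of_nonneg (taylorQuotient_nonneg F x h)]
    refine (ENNReal.ofReal_le_ofReal (taylorQuotient_le hF hk hs.le hb x h)).trans_eq ?_
    rw [ENNReal.ofReal_mul (by positivity), ← ENNReal.ofReal_rpow_of_nonneg (by positivity) hs.le,
      ENNReal.ofReal_add (norm_nonneg _) (norm_nonneg _), ofReal_norm, ofReal_norm]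
  have hrs : 0 ≤ r / s := by positivity
  calc _ ≤ (ENNReal.ofReal (2 * k) * (‖x‖ₑ + ‖h‖ₑ) ^ s) ^ (r / s) := by gcongr
    _ = ENNReal.ofReal (2 * k) ^ (r / s) * (‖x‖ₑ + ‖h‖ₑ) ^ r := by
      rw [ENNReal.mul_rpow_of_nonneg _ _ hrs, ← ENNReal.rpow_mul, mul_div_cancel₀ _ hs.ne']
    _ ≤ ENNReal.ofReal (2 * k) ^ (r / s) * (2 ^ (r - 1) * (‖x‖ₑ ^ r + ‖h‖ₑ ^ r)) := by
      gcongr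
      exact ENNReal.rpow_add_le_mul_rpow_add_rpow _ _ hr
    _ = _ := by ring

lemma tendsto_eLpNorm_taylorQuotient {F : X → E} (hF : ContDiff ℝ 1 F) {k s r : ℝ} (hk : 0 ≤ k)
    (hs : 0 < s) (hr : 1 ≤ r) [Fact (1 ≤ ENNReal.ofReal r)]
    (hb : ∀ x, ‖fderiv ℝ F x‖ ≤ k * ‖x‖ ^ s) (y : Lp X (ENNReal.ofReal r) μ) :
    Tendsto (fun h : Lp X (ENNReal.ofReal r) μ =>
      eLpNorm (fun ω => taylorQuotient F (y ω) (h ω)) (ENNReal.ofReal (r / s)) μ)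
      (𝓝 0) (𝓝 0) := by
  have hr0 : 0 < r := by linarith
  have hrs : 0 < r / s := by positivity
  have hFd : Differentiable ℝ F := hF.differentiable one_ne_zero
  refine tendsto_of_subseq_tendsto fun h hh => ?_
  obtain ⟨ns, hns, hae⟩ := (tendstoInMeasure_of_tendsto_Lp hh).exists_seq_tendsto_ae
  refine ⟨ns, ?_⟩
  set C : ℝ≥0∞ := ENNReal.ofReal (2 * k) ^ (r / s) * 2 ^ (r - 1) with hC
  have hCtop : C ≠ ∞ :=
    ENNReal.mul_ne_top (ENNReal.rpow_ne_top_of_nonneg hrs.le ENNReal.ofReal_ne_top)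
      (ENNReal.rpow_ne_top_of_nonneg (by linarith) ENNReal.ofNat_ne_top)
  have hle := enorm_taylorQuotient_rpow_le hFd hk hs hr hb
  simp only [← hC] at hle
  have hmeas : ∀ n, AEMeasurable
      (fun ω => ‖taylorQuotient F (y ω) (h (ns n) ω)‖ₑ ^ (r / s)) μ := fun n =>
    (aestronglyMeasurable_taylorQuotient hF (Lp.aestronglyMeasurable y)
      (Lp.aestronglyMeasurable (h (ns n)))).enorm.pow_const _
  have hmeas' : ∀ n, AEMeasurable (fun ω => C * ‖h (ns n) ω‖ₑ ^ r) μ := fun n =>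
    ((Lp.aestronglyMeasurable (h (ns n))).enorm.pow_const _).const_mul _
  -- the part of the quotient not controlled by the increment is dominated by `y`
  have hdom : Tendsto (fun n => ∫⁻ ω, (‖taylorQuotient F (y ω) (h (ns n) ω)‖ₑ ^ (r / s)
      - C * ‖h (ns n) ω‖ₑ ^ r) ∂μ) atTop (𝓝 (∫⁻ _, 0 ∂μ)) := by
    refine tendsto_lintegral_of_dominated_convergence' (fun ω => C * ‖y ω‖ₑ ^ r)
      (fun n => (hmeas n).sub (hmeas' n))
      (fun n => ae_of_all _ fun ω => tsub_le_iff_right.2 (hle _ _)) ?_ ?_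
    · rw [lintegral_const_mul' _ _ hCtop, lintegral_enorm_rpow_eq hr0]
      exact ENNReal.mul_ne_top hCtop (ENNReal.rpow_ne_top_of_nonneg hr0.le (Lp.eLpNorm_ne_top y))
    · filter_upwards [hae, Lp.coeFn_zero X (ENNReal.ofReal r) μ] with ω hω h0
      rw [h0] at hω
      have h1 := (tendsto_taylorQuotient (hFd (y ω))).comp hω
      have h2 : Tendsto (fun n => ‖taylorQuotient F (y ω) (h (ns n) ω)‖ₑ ^ (r / s)) atTop
          (𝓝 0) := by
        have := h1.enorm.ennrpow_const (r / s)
        simpa [ENNReal.zero_rpow_of_pos hrs] using this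
      exact tendsto_of_tendsto_of_tendsto_of_le_of_le tendsto_const_nhds h2
        (fun _ => zero_le) (fun _ => tsub_le_self)
  have hincr : Tendsto (fun n => ∫⁻ ω, C * ‖h (ns n) ω‖ₑ ^ r ∂μ) atTop (𝓝 0) := by
    simp_rw [lintegral_const_mul' _ _ hCtop, lintegral_enorm_rpow_eq hr0, ← Lp.enorm_def]
    have := ((hh.comp hns.tendsto_atTop).enorm.ennrpow_const r)
    simpa [ENNReal.zero_rpow_of_pos hr0] using ENNReal.Tendsto.const_mul this (Or.inr hCtop)
  have hint : Tendsto (fun n => ∫⁻ ω, ‖taylorQuotient F (y ω) (h (ns n) ω)‖ₑ ^ (r / s) ∂μ) atTop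
      (𝓝 0) := by
    have hsum := hdom.add hincr
    rw [lintegral_zero, add_zero] at hsum
    refine tendsto_of_tendsto_of_tendsto_of_le_of_le tendsto_const_nhds hsum
      (fun _ => zero_le) (fun n => ?_)
    simp only
    rw [← lintegral_add_right' _ (hmeas' n)]
    exact lintegral_mono fun ω => le_tsub_add
  have hfin := hint.ennrpow_const (1 / (r / s))
  rw [ENNReal.zero_rpow_of_pos (by positivity)] at hfin
  refine hfin.congr fun n => ?_
  rw [eLpNorm_eq_lintegral_rpow_enorm_toReal (by simpa using hrs) ENNReal.ofReal_ne_top,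
    ENNReal.toReal_ofReal hrs.le]

/-- Superposition operators of `C¹` functions whose derivative has growth of order `s > 0` are
Fréchet differentiable between the corresponding Lebesgue spaces. -/
theorem hasFDerivAt_toLp_comp {F : X → E} (hF : ContDiff ℝ 1 F) {k s r : ℝ} (hk : 0 ≤ k)
    (hs : 0 < s) (hr : 1 ≤ r) [Fact (1 ≤ ENNReal.ofReal r)] {p : ℝ≥0∞} [Fact (1 ≤ p)]
    (hp : (ENNReal.ofReal r / ENNReal.ofReal s).HolderTriple (ENNReal.ofReal r) p)
    (hb : ∀ x, ‖fderiv ℝ F x‖ ≤ k * ‖x‖ ^ s)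
    (hmem : ∀ z : Lp X (ENNReal.ofReal r) μ, MemLp (fun ω => F (z ω)) p μ)
    (y : Lp X (ENNReal.ofReal r) μ) (A : Lp X (ENNReal.ofReal r) μ →L[ℝ] Lp E p μ)
    (hA : ∀ h, A h =ᵐ[μ] fun ω => fderiv ℝ F (y ω) (h ω)) :
    HasFDerivAt (fun z => (hmem z).toLp) A y := by
  rw [← ENNReal.ofReal_div_of_pos hs] at hp
  have hlim := tendsto_eLpNorm_taylorQuotient hF hk hs hr hb y
  rw [hasFDerivAt_iff_isLittleO_nhds_zero, Asymptotics.isLittleO_iff]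
  intro c hc
  filter_upwards [hlim.eventually_le_const (ENNReal.ofReal_pos.2 hc)] with h hh
  have hae : ((hmem (y + h)).toLp - (hmem y).toLp - A h : Lp E p μ) =ᵐ[μ]
      fun ω => F (y ω + h ω) - F (y ω) - fderiv ℝ F (y ω) (h ω) := by
    filter_upwards [Lp.coeFn_sub ((hmem (y + h)).toLp - (hmem y).toLp) (A h),
      Lp.coeFn_sub (hmem (y + h)).toLp (hmem y).toLp, (hmem (y + h)).coeFn_toLp,
      (hmem y).coeFn_toLp, hA h, Lp.coeFn_add y h] with ω h1 h2 h3 h4 h5 h6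
    rw [h1, Pi.sub_apply, h2, Pi.sub_apply, h3, h4, h5, h6, Pi.add_apply]
  have hle : eLpNorm (fun ω => F (y ω + h ω) - F (y ω) - fderiv ℝ F (y ω) (h ω)) p μ ≤
      ENNReal.ofReal c * eLpNorm h (ENNReal.ofReal r) μ := by
    have h1 := eLpNorm_smul_le_mul_eLpNorm (hpqr := hp) (Lp.aestronglyMeasurable h).norm
      (aestronglyMeasurable_taylorQuotient hF (Lp.aestronglyMeasurable y)
        (Lp.aestronglyMeasurable h))
    rw [eLpNorm_norm] at h1
    refine le_trans (le_of_eq ?_) (h1.trans (by gcongr))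
    rw [← eLpNorm_norm]
    congr 1
    ext ω
    simp [taylorQuotient_mul_norm]
  rw [Lp.norm_def, Lp.norm_def, eLpNorm_congr_ae hae]
  refine (ENNReal.toReal_mono (ENNReal.mul_ne_top ENNReal.ofReal_ne_top
    (Lp.eLpNorm_ne_top h)) hle).trans_eq ?_
  rw [ENNReal.toReal_mul, ENNReal.toReal_ofReal hc.le]

/-- A field of operators of growth order `s` along `y ∈ L^r` acts boundedly from `L^r` to `L^p`,
for the exponent `p` given by Hölder's inequality. -/
lemma exists_continuousLinearMap_Lp {G : X → X →L[ℝ] E} (hG : Continuous G) {k s r : ℝ}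
    (hs : 0 ≤ s) [Fact (1 ≤ ENNReal.ofReal r)] {p : ℝ≥0∞} [Fact (1 ≤ p)]
    [Fact (1 ≤ ENNReal.ofReal r / ENNReal.ofReal s)]
    [(ENNReal.ofReal r / ENNReal.ofReal s).HolderTriple (ENNReal.ofReal r) p]
    (hb : ∀ x, ‖G x‖ ≤ k * ‖x‖ ^ s) (y : Lp X (ENNReal.ofReal r) μ) :
    ∃ A : Lp X (ENNReal.ofReal r) μ →L[ℝ] Lp E p μ,
      ∀ h, A h =ᵐ[μ] fun ω => G (y ω) (h ω) := by
  have hmem := memLp_comp_of_norm_le_rpow hG hs hb y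
  refine ⟨(ContinuousLinearMap.id ℝ (X →L[ℝ] E)).holderL μ _ _ p hmem.toLp, fun h => ?_⟩
  filter_upwards [(ContinuousLinearMap.id ℝ (X →L[ℝ] E)).coeFn_holder (r := p) hmem.toLp h,
    hmem.coeFn_toLp] with ω h1 h2
  exact h1.trans (by rw [h2]; rfl)

end Nemytskii

/-- The derivative of a squared norm is homogeneous of degree one; hence if it is differentiable at
the origin it is linear. -/
lemma fderiv_norm_rpow_two_eq {X : Type*} [NormedAddCommGroup X] [NormedSpace ℝ X]
    (h1 : Differentiable ℝ fun x : X => ‖x‖ ^ (2 : ℝ))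
    (h2 : DifferentiableAt ℝ (fderiv ℝ fun x : X => ‖x‖ ^ (2 : ℝ)) 0) :
    fderiv ℝ (fun x : X => ‖x‖ ^ (2 : ℝ)) =
      fderiv ℝ (fderiv ℝ fun x : X => ‖x‖ ^ (2 : ℝ)) 0 := by
  set φ : X → ℝ := fun x => ‖x‖ ^ (2 : ℝ) with hφ
  have hhom : ∀ (t : ℝ), t ≠ 0 → ∀ x, fderiv ℝ φ (t • x) = t • fderiv ℝ φ x := by
    intro t ht x
    have ha : (fun x => φ (t • x)) = fun x => t ^ 2 • φ x := by
      ext z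
      simp [hφ, norm_smul, mul_pow]
    have hb := congrArg (fun f => fderiv ℝ f x) ha
    rw [fderiv_comp_smul, fderiv_fun_const_smul (h1 x), pow_two, mul_smul] at hb
    exact smul_right_injective _ ht hb
  have h0 : fderiv ℝ φ 0 = 0 := by
    have := hhom 2 two_ne_zero 0
    rw [smul_zero, two_smul] at this
    simpa using this
  ext1 x
  have hd : HasDerivAt (fun t : ℝ => fderiv ℝ φ (t • x)) (fderiv ℝ (fderiv ℝ φ) 0 x) 0 := by
    have hl : HasDerivAt (fun t : ℝ => t • x) x 0 := by
      simpa using (hasDerivAt_id (0 : ℝ)).smul_const x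
    exact HasFDerivAt.comp_hasDerivAt (0 : ℝ) (by simpa using h2.hasFDerivAt) hl
  have hd' : HasDerivAt (fun t : ℝ => fderiv ℝ φ (t • x)) (fderiv ℝ φ x) 0 := by
    have hl : HasDerivAt (fun t : ℝ => t • fderiv ℝ φ x) (fderiv ℝ φ x) 0 := by
      simpa using (hasDerivAt_id (0 : ℝ)).smul_const (fderiv ℝ φ x)
    refine hl.congr_of_eventuallyEq (Eventually.of_forall fun t => ?_)
    rcases eq_or_ne t 0 with rfl | ht
    · simp [h0]
    · exact hhom t ht x
  exact hd'.unique hd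

/-- If `X` satisfies condition `(C_r)` with `φ x = ‖x‖^r`, then the second Fréchet derivative of
`ψ : L^r(Ω;X) → ℝ`, `ψ y = ‖y‖^r`, is given by
`ψ''(y)(u,v) = ∫_Ω φ''(y(ω))(u(ω), v(ω)) dP(ω)`. -/
theorem second_fderiv_norm_rpow_Lp {X : Type*} [NormedAddCommGroup X] [NormedSpace ℝ X]
    [CompleteSpace X]
    {Ω : Type*} [MeasurableSpace Ω] (P : Measure Ω) [IsProbabilityMeasure P]
    (r k₁ k₂ : ℝ) (hr : 2 ≤ r) (hk₁ : 0 < k₁) (hk₂ : 0 < k₂)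
    [Fact (1 ≤ ENNReal.ofReal r)]
    (hX : ConditionCr X r k₁ k₂)
    (y u v : Lp X (ENNReal.ofReal r) P) :
    fderiv ℝ (fderiv ℝ (fun z : Lp X (ENNReal.ofReal r) P => ‖z‖ ^ r)) y u v
      = ∫ ω, fderiv ℝ (fderiv ℝ (fun x : X => ‖x‖ ^ r)) (y ω) (u ω) (v ω) ∂P := by
  obtain ⟨hC2, hb1, hb2⟩ := hX
  set φ : X → ℝ := fun x => ‖x‖ ^ r with hφ
  have hr0 : 0 < r := by linarith
  have hr1 : 1 ≤ r := by linarith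
  have hφ1 : ContDiff ℝ 1 φ := hC2.of_le (by norm_num)
  have hφ' : ContDiff ℝ 1 (fderiv ℝ φ) := hC2.fderiv_right (by norm_num)
  have hφ'' : Continuous (fderiv ℝ (fderiv ℝ φ)) := hφ'.continuous_fderiv one_ne_zero
  set q := ENNReal.ofReal r / ENNReal.ofReal (r - 2) with hq
  set p := ENNReal.ofReal r / ENNReal.ofReal (r - 1) with hp
  have : Fact (1 ≤ q) := fact_one_le_ofReal_div hr0 (by linarith)
  have : Fact (1 ≤ p) := fact_one_le_ofReal_div hr0 (by linarith)
  have hqp : q.HolderTriple (ENNReal.ofReal r) p := by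
    have := holderTriple_ofReal_div hr0 (s := r - 2) (by linarith)
    rwa [show r - 2 + 1 = r - 1 by ring] at this
  have hpc : p.HolderTriple (ENNReal.ofReal r) 1 := by
    have := holderTriple_ofReal_div hr0 (s := r - 1) (by linarith)
    rwa [sub_add_cancel, ENNReal.div_self (by simpa using hr0) ENNReal.ofReal_ne_top] at this
  have : p.HolderConjugate (ENNReal.ofReal r) := hpc
  have hmem0 : ∀ z : Lp X (ENNReal.ofReal r) P, MemLp (fun ω => φ (z ω)) 1 P := fun z => by
    have := (Lp.memLp z).norm_rpow (by simpa using hr0) ENNReal.ofReal_ne_top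
    rwa [ENNReal.toReal_ofReal hr0.le] at this
  have hmem1 : ∀ z : Lp X (ENNReal.ofReal r) P, MemLp (fun ω => fderiv ℝ φ (z ω)) p P :=
    memLp_comp_of_norm_le_rpow hφ'.continuous (sub_nonneg.2 hr1) hb1
  set pairing := ContinuousLinearMap.lpPairing P p (ENNReal.ofReal r)
    (ContinuousLinearMap.id ℝ (X →L[ℝ] ℝ)) with hpairing
  have hfirst : ∀ z : Lp X (ENNReal.ofReal r) P,
      HasFDerivAt (fun z : Lp X (ENNReal.ofReal r) P => ‖z‖ ^ r)
      (pairing (hmem1 z).toLp) z := by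
    intro z
    obtain ⟨A, hA⟩ := exists_continuousLinearMap_Lp (p := 1) hφ'.continuous
      (sub_nonneg.2 hr1) hb1 z
    have hd := hasFDerivAt_toLp_comp hφ1 hk₁.le (by linarith) hr1 hpc hb1 hmem0 z A hA
    have hd' := (L1.integralCLM (μ := P) (E := ℝ)).hasFDerivAt.comp z hd
    have he : (fun z : Lp X (ENNReal.ofReal r) P => ‖z‖ ^ r) =
        (L1.integralCLM (μ := P) (E := ℝ)) ∘ fun z => (hmem0 z).toLp := by
      ext w
      rw [norm_rpow_eq_integral hr0, Function.comp_apply, ← L1.integral_eq, L1.integral_eq_integral]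
      exact integral_congr_ae (hmem0 w).coeFn_toLp.symm
    rw [he]
    refine hd'.congr_fderiv (ContinuousLinearMap.ext fun h => ?_)
    rw [ContinuousLinearMap.comp_apply, ← L1.integral_eq, L1.integral_eq_integral, hpairing,
      ContinuousLinearMap.lpPairing_eq_integral]
    refine integral_congr_ae ?_
    filter_upwards [hA h, (hmem1 z).coeFn_toLp] with ω h1 h2
    rw [h1, h2]
    rfl
  have hψ' : fderiv ℝ (fun z : Lp X (ENNReal.ofReal r) P => ‖z‖ ^ r) =
      fun z => pairing (hmem1 z).toLp :=
    funext fun z => (hfirst z).fderiv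
  obtain ⟨A, hA⟩ := exists_continuousLinearMap_Lp (E := X →L[ℝ] ℝ) (p := p) hφ''
    (sub_nonneg.2 hr) hb2 y
  have hsecond : HasFDerivAt (fun z => (hmem1 z).toLp) A y := by
    rcases hr.eq_or_lt with h2 | h2
    · have hlin : fderiv ℝ φ = fderiv ℝ (fderiv ℝ φ) 0 := by
        have hd1 := hφ1.differentiable one_ne_zero
        have hd2 := (hφ'.differentiable one_ne_zero) 0
        rw [hφ, ← h2] at hd1 hd2 ⊢
        exact fderiv_norm_rpow_two_eq hd1 hd2
      have hconst : ∀ x, fderiv ℝ (fderiv ℝ φ) x = fderiv ℝ (fderiv ℝ φ) 0 := by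
        intro x
        conv_lhs => rw [hlin]
        exact (fderiv ℝ (fderiv ℝ φ) 0).fderiv
      have : (fun z => (hmem1 z).toLp) = A := by
        ext1 z
        refine Lp.ext ?_
        filter_upwards [(hmem1 z).coeFn_toLp, hA z] with ω h3 h4
        rw [h3, h4, hconst, congrFun hlin (z ω)]
      rw [this]
      exact A.hasFDerivAt
    · exact hasFDerivAt_toLp_comp hφ' hk₂.le (by linarith) hr1 hqp hb2 hmem1 y A hA
  have hcomp : HasFDerivAt (fun z => pairing (hmem1 z).toLp) (pairing.comp A) y :=
    pairing.hasFDerivAt.comp y hsecond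
  rw [hψ', hcomp.fderiv, ContinuousLinearMap.comp_apply, hpairing,
    ContinuousLinearMap.lpPairing_eq_integral]
  refine integral_congr_ae ?_
  filter_upwards [hA u] with ω hω
  rw [hω]
  rfl
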